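/- Let (x, y) be a random pair with x ∈ ℝ^d satisfying ‖x‖_∞ ≤ C almost surely (for some C > 0) and E[xxᵀ] = σ₁² I_d (for some σ₁ > 0), and y ∈ {0, 1}. Define the population logistic loss f(w) := E[ −y log σ(⟨x, w⟩) − (1−y) log σ(−⟨x, w⟩) ], where σ(z) = 1/(1 + e^{−z}). Then for every Q > 0 and every w ∈ ℝ^d with ‖w‖_1² ≤ Q, the Hessian satisfies ∇²f(w) ⪰ σ₁² σ(C√Q) σ(−C√Q) I_d, i.e. uᵀ∇²f(w)u ≥ σ₁² σ(C√Q) σ(−C√Q) ‖u‖_2² for all u ∈ ℝ^d. In particular, f is μ(Q)-strongly convex on { w : ‖w‖_1² ≤ Q } with μ(Q) = σ₁² σ(C√Q) σ(−C√Q). -/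

import Mathlib

noncomputable section

open Real MeasureTheory
open scoped RealInnerProductSpace

/-- The ℓ_1 norm of a vector in ℝ^d. -/
def l1Norm {d : ℕ} (x : Fin d → ℝ) : ℝ := ∑ i, |x i|


def sg (z : ℝ) : ℝ := (1 + Real.exp (-z))⁻¹
def spl (z : ℝ) : ℝ := Real.log (1 + Real.exp z)

lemma sg_pos (z : ℝ) : 0 < sg z := by unfold sg; positivity
lemma sg_lt (z : ℝ) : sg z < 1 := by
  unfold sg
  have := Real.exp_pos (-z)
  exact inv_lt_one_of_one_lt₀ (by linarith)

lemma sg_mul (z : ℝ) : sg z * sg (-z) = (2 + 2 * Real.cosh z)⁻¹ := by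
  unfold sg
  rw [← mul_inv, Real.cosh_eq, neg_neg]
  congr 1
  have : Real.exp (-z) * Real.exp z = 1 := by rw [← Real.exp_add]; simp
  linear_combination this

lemma sg_mul_mono {z R : ℝ} (h : |z| ≤ R) : sg R * sg (-R) ≤ sg z * sg (-z) := by
  rw [sg_mul, sg_mul]
  have h1 : Real.cosh z ≤ Real.cosh R := Real.cosh_le_cosh.2 (h.trans (le_abs_self R))
  have h2 := Real.cosh_pos z
  exact inv_anti₀ (by linarith) (by linarith)

lemma hasDerivAt_sg (z : ℝ) : HasDerivAt sg (sg z * sg (-z)) z := by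
  have h1 : HasDerivAt (fun z : ℝ => 1 + Real.exp (-z)) (-Real.exp (-z)) z := by
    simpa using ((hasDerivAt_neg z).exp).const_add 1
  refine (h1.inv (by positivity)).congr_deriv ?_
  unfold sg
  have : Real.exp (-z) * Real.exp z = 1 := by rw [← Real.exp_add]; simp
  have h3 := Real.exp_pos z
  have h4 := Real.exp_pos (-z)
  rw [neg_neg]
  field_simp
  linear_combination this

lemma hasDerivAt_spl (z : ℝ) : HasDerivAt spl (sg z) z := by
  have h1 : HasDerivAt (fun z : ℝ => 1 + Real.exp z) (Real.exp z) z :=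
    (Real.hasDerivAt_exp z).const_add 1
  refine (h1.log (by positivity)).congr_deriv ?_
  unfold sg
  have : Real.exp (-z) * Real.exp z = 1 := by rw [← Real.exp_add]; simp
  have h3 := Real.exp_pos z
  have h4 := Real.exp_pos (-z)
  field_simp
  linear_combination this

lemma cont_spl : Continuous spl :=
  continuous_iff_continuousAt.2 fun z => (hasDerivAt_spl z).continuousAt
lemma cont_sg : Continuous sg :=
  continuous_iff_continuousAt.2 fun z => (hasDerivAt_sg z).continuousAt

lemma log_sg (z : ℝ) : Real.log (sg z) = z - spl z := by
  unfold sg spl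
  rw [Real.log_inv]
  have : 1 + Real.exp z = Real.exp z * (1 + Real.exp (-z)) := by
    rw [mul_add, ← Real.exp_add]; simp [add_comm]
  rw [this, Real.log_mul (by positivity) (by positivity), Real.log_exp]
  ring

lemma log_sg_neg (z : ℝ) : Real.log (sg (-z)) = - spl z := by
  unfold sg spl
  rw [Real.log_inv, neg_neg]

lemma spl_strong (R : ℝ) : ConvexOn ℝ (Set.Icc (-R) R)
    (fun z => spl z - (sg R * sg (-R)) / 2 * z ^ 2) := by
  set m := sg R * sg (-R)
  have hd1 : ∀ z, HasDerivAt (fun z => spl z - m / 2 * z ^ 2) (sg z - m * z) z := by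
    intro z
    refine ((hasDerivAt_spl z).sub ((hasDerivAt_pow 2 z).const_mul (m / 2))).congr_deriv ?_
    norm_num; ring
  have hd2 : ∀ z, HasDerivAt (fun z => sg z - m * z) (sg z * sg (-z) - m) z := by
    intro z
    refine ((hasDerivAt_sg z).sub ((hasDerivAt_id z).const_mul m)).congr_deriv ?_
    simp
  refine convexOn_of_hasDerivWithinAt2_nonneg (f' := fun z => sg z - m * z)
    (f'' := fun z => sg z * sg (-z) - m) (convex_Icc _ _) ?_ ?_ ?_ ?_
  · exact fun z _ => (hd1 z).continuousAt.continuousWithinAt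
  · exact fun z _ => (hd1 z).hasDerivWithinAt
  · exact fun z _ => (hd2 z).hasDerivWithinAt
  · intro z hz
    have hz := interior_subset hz
    have := sg_mul_mono (abs_le.2 hz)
    linarith

section main
variable {d : ℕ} {Ω : Type} [mΩ : MeasurableSpace Ω] {P : Measure Ω}
  [hP : IsProbabilityMeasure P]
  {x : Ω → EuclideanSpace ℝ (Fin d)} {y : Ω → ℝ} {K : ℝ}

lemma int_loss (hx : Measurable x) (hy : Measurable y)
    (hK : ∀ᵐ ω ∂P, ‖x ω‖ ≤ K) (hy01 : ∀ ω, y ω = 0 ∨ y ω = 1) (w : EuclideanSpace ℝ (Fin d)) :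
    Integrable (fun ω => spl ⟪x ω, w⟫ - y ω * ⟪x ω, w⟫) P := by
  have hm : Measurable (fun ω => ⟪x ω, w⟫) := hx.inner measurable_const
  obtain ⟨B, hB⟩ := (isCompact_Icc (a := -(K * ‖w‖)) (b := K * ‖w‖)).exists_bound_of_continuousOn
    cont_spl.continuousOn
  refine Integrable.of_bound (C := B + K * ‖w‖)
    ((cont_spl.measurable.comp hm).sub (hy.mul hm)).aestronglyMeasurable ?_
  filter_upwards [hK] with ω h
  have h1 : |⟪x ω, w⟫| ≤ K * ‖w‖ := (abs_real_inner_le_norm _ _).trans (by gcongr)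
  have h2 := hB _ (abs_le.1 h1)
  refine (norm_sub_le _ _).trans (add_le_add h2 ?_)
  rw [norm_mul, Real.norm_eq_abs, Real.norm_eq_abs]
  rcases hy01 ω with h | h <;> rw [h] <;> simp
  · exact (abs_nonneg _).trans h1
  · exact h1

lemma int_F1 (hx : Measurable x) (hy : Measurable y)
    (hK : ∀ᵐ ω ∂P, ‖x ω‖ ≤ K) (hy01 : ∀ ω, y ω = 0 ∨ y ω = 1) (w : EuclideanSpace ℝ (Fin d)) :
    Integrable (fun ω => (sg ⟪x ω, w⟫ - y ω) • innerSL ℝ (x ω)) P := by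
  have hm : Measurable (fun ω => ⟪x ω, w⟫) := hx.inner measurable_const
  have hs : Measurable (fun ω => sg ⟪x ω, w⟫ - y ω) := (cont_sg.measurable.comp hm).sub hy
  refine Integrable.of_bound (C := K) (hs.aestronglyMeasurable.smul
    ((innerSL ℝ).continuous.comp_aestronglyMeasurable hx.aestronglyMeasurable)) ?_
  filter_upwards [hK] with ω h
  rw [norm_smul, innerSL_apply_norm]
  have h1 : ‖sg ⟪x ω, w⟫ - y ω‖ ≤ 1 := by
    have := sg_pos ⟪x ω, w⟫
    have := sg_lt ⟪x ω, w⟫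
    rw [Real.norm_eq_abs, abs_le]
    rcases hy01 ω with h | h <;> rw [h] <;> constructor <;> linarith
  calc _ ≤ 1 * ‖x ω‖ := by gcongr
    _ ≤ K := by simpa

lemma norm_F1_le (hy01 : ∀ ω, y ω = 0 ∨ y ω = 1) (w : EuclideanSpace ℝ (Fin d)) (ω : Ω)
    (h : ‖x ω‖ ≤ K) : ‖(sg ⟪x ω, w⟫ - y ω) • innerSL ℝ (x ω)‖ ≤ K := by
  rw [norm_smul, innerSL_apply_norm]
  have h1 : ‖sg ⟪x ω, w⟫ - y ω‖ ≤ 1 := by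
    have := sg_pos ⟪x ω, w⟫
    have := sg_lt ⟪x ω, w⟫
    rw [Real.norm_eq_abs, abs_le]
    rcases hy01 ω with h | h <;> rw [h] <;> constructor <;> linarith
  calc _ ≤ 1 * ‖x ω‖ := by gcongr
    _ ≤ K := by simpa

lemma hasFDerivAt_inner (a w : EuclideanSpace ℝ (Fin d)) :
    HasFDerivAt (fun w => ⟪a, w⟫) (innerSL ℝ a) w := (innerSL ℝ a).hasFDerivAt

lemma fderiv_loss (hx : Measurable x) (hy : Measurable y)
    (hK : ∀ᵐ ω ∂P, ‖x ω‖ ≤ K) (hy01 : ∀ ω, y ω = 0 ∨ y ω = 1) (w : EuclideanSpace ℝ (Fin d)) :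
    HasFDerivAt (fun w => ∫ ω, (spl ⟪x ω, w⟫ - y ω * ⟪x ω, w⟫) ∂P)
      (∫ ω, (sg ⟪x ω, w⟫ - y ω) • innerSL ℝ (x ω) ∂P) w := by
  refine hasFDerivAt_integral_of_dominated_of_fderiv_le (bound := fun _ => K)
    (F' := fun w ω => (sg ⟪x ω, w⟫ - y ω) • innerSL ℝ (x ω)) (s := Set.univ) Filter.univ_mem
    (Filter.Eventually.of_forall fun w => (int_loss hx hy hK hy01 w).aestronglyMeasurable)
    (int_loss hx hy hK hy01 w) (int_F1 hx hy hK hy01 w).aestronglyMeasurable ?_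
    (integrable_const _) ?_
  · filter_upwards [hK] with ω h w _
    exact norm_F1_le hy01 w ω h
  · refine Filter.Eventually.of_forall fun ω w _ => ?_
    have h1 := hasFDerivAt_inner (x ω) w
    refine (((hasDerivAt_spl _).comp_hasFDerivAt w h1).sub (h1.const_mul (y ω))).congr_fderiv ?_
    rw [sub_smul]

set_option maxSynthPendingDepth 5

lemma int_F2 (hx : Measurable x)
    (hK : ∀ᵐ ω ∂P, ‖x ω‖ ≤ K) (w : EuclideanSpace ℝ (Fin d)) :
    Integrable (fun ω => ((sg ⟪x ω, w⟫ * sg (-⟪x ω, w⟫)) • innerSL ℝ (x ω)).smulRight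
      (innerSL ℝ (x ω))) P ∧ ∀ᵐ ω ∂P, ∀ w, ‖((sg ⟪x ω, w⟫ * sg (-⟪x ω, w⟫)) •
        innerSL ℝ (x ω)).smulRight (innerSL ℝ (x ω))‖ ≤ K * K := by
  have hb : ∀ᵐ ω ∂P, ∀ w, ‖((sg ⟪x ω, w⟫ * sg (-⟪x ω, w⟫)) •
        innerSL ℝ (x ω)).smulRight (innerSL ℝ (x ω))‖ ≤ K * K := by
    filter_upwards [hK] with ω h w
    rw [ContinuousLinearMap.norm_smulRight_apply, norm_smul, innerSL_apply_norm]
    have a1 := sg_pos ⟪x ω, w⟫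
    have a2 := sg_lt ⟪x ω, w⟫
    have a3 := sg_pos (-⟪x ω, w⟫)
    have a4 := sg_lt (-⟪x ω, w⟫)
    have h1 : ‖sg ⟪x ω, w⟫ * sg (-⟪x ω, w⟫)‖ ≤ 1 := by
      rw [Real.norm_eq_abs, abs_of_pos (by positivity)]
      nlinarith
    have hK0 : 0 ≤ K := (norm_nonneg _).trans h
    calc _ ≤ (1 * K) * K := by gcongr
      _ = K * K := by ring
  refine ⟨?_, hb⟩
  have hm : Measurable (fun ω => ⟪x ω, w⟫) := hx.inner measurable_const
  have hc : Continuous (fun a : EuclideanSpace ℝ (Fin d) =>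
    ((sg ⟪a, w⟫ * sg (-⟪a, w⟫)) • innerSL ℝ a).smulRight (innerSL ℝ a)) := by
    have h1 : Continuous (fun a : EuclideanSpace ℝ (Fin d) => ⟪a, w⟫) := by fun_prop
    have h2 : Continuous (fun a : EuclideanSpace ℝ (Fin d) => innerSL ℝ a) := (innerSL ℝ).continuous
    have h3 : Continuous (fun a : EuclideanSpace ℝ (Fin d) =>
      (sg ⟪a, w⟫ * sg (-⟪a, w⟫)) • innerSL ℝ a) :=
      ((cont_sg.comp h1).mul (cont_sg.comp h1.neg)).smul h2
    exact ((ContinuousLinearMap.smulRightL ℝ (EuclideanSpace ℝ (Fin d))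
      (EuclideanSpace ℝ (Fin d) →L[ℝ] ℝ)).continuous.comp h3).clm_apply h2
  refine Integrable.of_bound (C := K * K)
    (hc.comp_aestronglyMeasurable hx.aestronglyMeasurable) ?_
  filter_upwards [hb] with ω h
  exact h w

lemma fderiv2_loss (hx : Measurable x) (hy : Measurable y)
    (hK : ∀ᵐ ω ∂P, ‖x ω‖ ≤ K) (hy01 : ∀ ω, y ω = 0 ∨ y ω = 1) (w : EuclideanSpace ℝ (Fin d)) :
    HasFDerivAt (fun w => ∫ ω, (sg ⟪x ω, w⟫ - y ω) • innerSL ℝ (x ω) ∂P)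
      (∫ ω, ((sg ⟪x ω, w⟫ * sg (-⟪x ω, w⟫)) • innerSL ℝ (x ω)).smulRight
      (innerSL ℝ (x ω)) ∂P) w := by
  refine hasFDerivAt_integral_of_dominated_of_fderiv_le (bound := fun _ => K * K)
    (F' := fun w ω => ((sg ⟪x ω, w⟫ * sg (-⟪x ω, w⟫)) • innerSL ℝ (x ω)).smulRight
      (innerSL ℝ (x ω))) (s := Set.univ) Filter.univ_mem
    (Filter.Eventually.of_forall fun w => (int_F1 hx hy hK hy01 w).aestronglyMeasurable)
    (int_F1 hx hy hK hy01 w) (int_F2 hx hK w).1.aestronglyMeasurable ?_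
    (integrable_const _) ?_
  · filter_upwards [(int_F2 hx hK w).2] with ω h w _
    exact h w
  · refine Filter.Eventually.of_forall fun ω w _ => ?_
    have h1 := hasFDerivAt_inner (x ω) w
    exact (((hasDerivAt_sg _).comp_hasFDerivAt w h1).sub_const (y ω)).smul_const _

lemma hess_loss (hx : Measurable x) (hy : Measurable y)
    (hK : ∀ᵐ ω ∂P, ‖x ω‖ ≤ K) (hy01 : ∀ ω, y ω = 0 ∨ y ω = 1) (w u : EuclideanSpace ℝ (Fin d)) :
    iteratedFDeriv ℝ 2 (fun w => ∫ ω, (spl ⟪x ω, w⟫ - y ω * ⟪x ω, w⟫) ∂P) w ![u, u] =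
      ∫ ω, sg ⟪x ω, w⟫ * sg (-⟪x ω, w⟫) * ⟪x ω, u⟫ ^ 2 ∂P ∧
    Integrable (fun ω => sg ⟪x ω, w⟫ * sg (-⟪x ω, w⟫) * ⟪x ω, u⟫ ^ 2) P := by
  have h1 : fderiv ℝ (fun w => ∫ ω, (spl ⟪x ω, w⟫ - y ω * ⟪x ω, w⟫) ∂P) =
    fun w => ∫ ω, (sg ⟪x ω, w⟫ - y ω) • innerSL ℝ (x ω) ∂P :=
    funext fun w => (fderiv_loss hx hy hK hy01 w).fderiv
  have hi := (int_F2 hx hK w).1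
  have e : ∀ ω, sg ⟪x ω, w⟫ * sg (-⟪x ω, w⟫) * ⟪x ω, u⟫ ^ 2 =
     ((sg ⟪x ω, w⟫ * sg (-⟪x ω, w⟫)) • innerSL ℝ (x ω)).smulRight
      (innerSL ℝ (x ω)) u u := by
    intro ω
    simp [pow_two, mul_assoc]
  simp only [e]
  rw [iteratedFDeriv_two_apply, h1, (fderiv2_loss hx hy hK hy01 w).fderiv]
  have hi2 := hi.apply_continuousLinearMap u
  refine ⟨?_, hi2.apply_continuousLinearMap u⟩
  simp only [Matrix.cons_val_zero, Matrix.cons_val_one]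
  rw [ContinuousLinearMap.integral_apply hi, ContinuousLinearMap.integral_apply hi2]

lemma int_sq (hx : Measurable x)
    (hK : ∀ᵐ ω ∂P, ‖x ω‖ ≤ K) (u : EuclideanSpace ℝ (Fin d)) :
    Integrable (fun ω => ⟪x ω, u⟫ ^ 2) P := by
  have hm : Measurable (fun ω => ⟪x ω, u⟫) := hx.inner measurable_const
  refine Integrable.of_bound (C := (K * ‖u‖) ^ 2) (hm.pow_const 2).aestronglyMeasurable ?_
  filter_upwards [hK] with ω h
  rw [norm_pow, Real.norm_eq_abs]
  have h1 : |⟪x ω, u⟫| ≤ K * ‖u‖ := (abs_real_inner_le_norm _ _).trans (by gcongr)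
  gcongr

lemma cov_eq (hx : Measurable x)
    (hK : ∀ᵐ ω ∂P, ‖x ω‖ ≤ K) {σ1 : ℝ} (hxcov : ∀ i j : Fin d,
      ∫ ω, x ω i * x ω j ∂P = if i = j then σ1 ^ 2 else 0) (u : EuclideanSpace ℝ (Fin d)) :
    ∫ ω, ⟪x ω, u⟫ ^ 2 ∂P = σ1 ^ 2 * ‖u‖ ^ 2 := by
  have hm : ∀ i, Measurable (fun ω => x ω i) := fun i =>
    (by fun_prop : Continuous (fun a : EuclideanSpace ℝ (Fin d) => a i)).measurable.comp hx
  have hi : ∀ i j, Integrable (fun ω => u i * u j * (x ω i * x ω j)) P := by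
    intro i j
    refine Integrable.const_mul ?_ _
    refine Integrable.of_bound (C := K * K) ((hm i).mul (hm j)).aestronglyMeasurable ?_
    filter_upwards [hK] with ω h
    rw [norm_mul]
    have := (norm_nonneg _).trans h
    have h1 := (PiLp.norm_apply_le (x ω) i).trans h
    have h2 := (PiLp.norm_apply_le (x ω) j).trans h
    gcongr
  have e : ∀ ω, ⟪x ω, u⟫ ^ 2 = ∑ i, ∑ j, u i * u j * (x ω i * x ω j) := by
    intro ω
    rw [PiLp.inner_apply, pow_two, Finset.sum_mul_sum]
    refine Finset.sum_congr rfl fun i _ => Finset.sum_congr rfl fun j _ => ?_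
    simp
    ring
  simp only [e]
  rw [integral_finsetSum _ fun i _ => integrable_finsetSum _ fun j _ => hi i j]
  rw [EuclideanSpace.norm_sq_eq, Finset.mul_sum]
  refine Finset.sum_congr rfl fun i _ => ?_
  rw [integral_finsetSum _ fun j _ => hi i j]
  simp only [integral_const_mul, hxcov]
  simp
  ring

lemma inner_le_l1 {C : ℝ} (a w : EuclideanSpace ℝ (Fin d)) (h : ∀ i, |a i| ≤ C) :
    |⟪a, w⟫| ≤ C * l1Norm (fun i => w i) := by
  rw [PiLp.inner_apply, l1Norm, Finset.mul_sum]
  refine (Finset.abs_sum_le_sum_abs _ _).trans (Finset.sum_le_sum fun i _ => ?_)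
  have := h i
  simp only [RCLike.inner_apply, conj_trivial, abs_mul]
  rw [mul_comm]
  gcongr

end main

/-- local strong convexity of the population logistic loss.
For a random pair `(x, y)` with `‖x‖_∞ ≤ C` a.s., `E[xxᵀ] = σ₁² I_d`, and
`y ∈ {0,1}`, the Hessian of the population logistic loss `f` satisfies
`uᵀ∇²f(w)u ≥ σ₁² σ(C√Q) σ(−C√Q) ‖u‖₂²` whenever `‖w‖₁² ≤ Q`; in particular,
`f` is `μ(Q)`-strongly convex on `{w : ‖w‖₁² ≤ Q}` with
`μ(Q) = σ₁² σ(C√Q) σ(−C√Q)`. -/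
theorem stmt18 (d : ℕ) (hd : 1 ≤ d) (C σ1 : ℝ) (hC : 0 < C) (hσ1 : 0 < σ1)
    (Ω : Type) (mΩ : MeasurableSpace Ω) (P : Measure Ω)
    (hP : IsProbabilityMeasure P)
    (x : Ω → EuclideanSpace ℝ (Fin d)) (y : Ω → ℝ)
    (hxmeas : Measurable x) (hymeas : Measurable y)
    (hxbdd : ∀ᵐ ω ∂P, ∀ i, |x ω i| ≤ C)
    (hxcov : ∀ i j : Fin d,
      ∫ ω, x ω i * x ω j ∂P = if i = j then σ1 ^ 2 else 0)
    (hy01 : ∀ ω, y ω = 0 ∨ y ω = 1)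
    (sig : ℝ → ℝ) (hsig : ∀ z, sig z = (1 + Real.exp (-z))⁻¹)
    (f : EuclideanSpace ℝ (Fin d) → ℝ)
    (hf : ∀ w, f w = ∫ ω, (-(y ω) * Real.log (sig ⟪x ω, w⟫) -
      (1 - y ω) * Real.log (sig (-⟪x ω, w⟫))) ∂P)
    (Q : ℝ) (hQ : 0 < Q) :
    (∀ w : EuclideanSpace ℝ (Fin d), l1Norm (fun i => w i) ^ 2 ≤ Q →
      ∀ u : EuclideanSpace ℝ (Fin d),
        σ1 ^ 2 * sig (C * Real.sqrt Q) * sig (-(C * Real.sqrt Q)) * ‖u‖ ^ 2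
          ≤ iteratedFDeriv ℝ 2 f w ![u, u]) ∧
      StrongConvexOn {w : EuclideanSpace ℝ (Fin d) | l1Norm (fun i => w i) ^ 2 ≤ Q}
        (σ1 ^ 2 * sig (C * Real.sqrt Q) * sig (-(C * Real.sqrt Q))) f := by
  obtain rfl : sig = sg := funext fun z => hsig z
  set R := C * Real.sqrt Q with hR
  set m := sg R * sg (-R) with hm
  have hK : ∀ᵐ ω ∂P, ‖x ω‖ ≤ Real.sqrt (∑ _i : Fin d, C ^ 2) := by
    filter_upwards [hxbdd] with ω h
    rw [EuclideanSpace.norm_eq]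
    refine Real.sqrt_le_sqrt (Finset.sum_le_sum fun i _ => ?_)
    have := h i
    rw [Real.norm_eq_abs]
    gcongr
  have hf' : f = fun w => ∫ ω, (spl ⟪x ω, w⟫ - y ω * ⟪x ω, w⟫) ∂P := by
    funext w
    rw [hf]
    refine integral_congr_ae (Filter.Eventually.of_forall fun ω => ?_)
    simp only [log_sg_neg]
    rw [log_sg]
    ring
  have hl1 : ∀ w : EuclideanSpace ℝ (Fin d), l1Norm (fun i => w i) ^ 2 ≤ Q →
      l1Norm (fun i => w i) ≤ Real.sqrt Q := fun w hw => Real.le_sqrt_of_sq_le hw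
  have hin : ∀ᵐ ω ∂P, ∀ w : EuclideanSpace ℝ (Fin d), l1Norm (fun i => w i) ^ 2 ≤ Q →
      |⟪x ω, w⟫| ≤ R := by
    filter_upwards [hxbdd] with ω h w hw
    refine (inner_le_l1 (x ω) w h).trans ?_
    have := hl1 w hw
    rw [hR]
    gcongr
  rw [mul_assoc, ← hm]
  constructor
  · intro w hw u
    obtain ⟨h1, h2⟩ := hess_loss hxmeas hymeas hK hy01 w u
    rw [hf', h1]
    calc _ = ∫ ω, m * ⟪x ω, u⟫ ^ 2 ∂P := by
            rw [integral_const_mul, cov_eq hxmeas hK hxcov]; ring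
      _ ≤ _ := by
        refine integral_mono_ae ((int_sq hxmeas hK u).const_mul m) h2 ?_
        filter_upwards [hin] with ω h
        exact mul_le_mul_of_nonneg_right (sg_mul_mono (h w hw)) (sq_nonneg _)
  · have hconv : Convex ℝ {w : EuclideanSpace ℝ (Fin d) | l1Norm (fun i => w i) ^ 2 ≤ Q} := by
      intro v hv w hw a b ha hb hab
      have h1 := hl1 v hv
      have h2 := hl1 w hw
      have h3 : l1Norm (fun i => (a • v + b • w) i) ≤
          a * l1Norm (fun i => v i) + b * l1Norm (fun i => w i) := by
        unfold l1Norm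
        rw [Finset.mul_sum, Finset.mul_sum, ← Finset.sum_add_distrib]
        refine Finset.sum_le_sum fun i _ => ?_
        simp only [PiLp.add_apply, PiLp.smul_apply, smul_eq_mul]
        refine (abs_add_le _ _).trans ?_
        rw [abs_mul, abs_mul, abs_of_nonneg ha, abs_of_nonneg hb]
      have h4 : 0 ≤ l1Norm (fun i => (a • v + b • w) i) :=
        Finset.sum_nonneg fun i _ => abs_nonneg _
      have h5 : l1Norm (fun i => (a • v + b • w) i) ≤ Real.sqrt Q := by
        have e : Real.sqrt Q = a * Real.sqrt Q + b * Real.sqrt Q := by rw [← add_mul, hab, one_mul]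
        rw [e]
        refine h3.trans ?_
        gcongr
      show _ ≤ Q
      calc _ ≤ Real.sqrt Q ^ 2 := by gcongr
        _ = Q := Real.sq_sqrt hQ.le
    rw [strongConvexOn_iff_convex]
    have hint : ∀ w, Integrable
        (fun ω => (spl ⟪x ω, w⟫ - y ω * ⟪x ω, w⟫) - m / 2 * ⟪x ω, w⟫ ^ 2) P := fun w =>
      (int_loss hxmeas hymeas hK hy01 w).sub ((int_sq hxmeas hK w).const_mul _)
    have hg : ∀ w, f w - σ1 ^ 2 * m / 2 * ‖w‖ ^ 2 =
        ∫ ω, ((spl ⟪x ω, w⟫ - y ω * ⟪x ω, w⟫) - m / 2 * ⟪x ω, w⟫ ^ 2) ∂P := by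
      intro w
      rw [integral_sub (int_loss hxmeas hymeas hK hy01 w) ((int_sq hxmeas hK w).const_mul _),
        integral_const_mul, cov_eq hxmeas hK hxcov, hf']
      ring
    refine ⟨hconv, ?_⟩
    intro v hv w hw a b ha hb hab
    simp only [hg, smul_eq_mul]
    rw [← integral_const_mul, ← integral_const_mul,
      ← integral_add ((hint v).const_mul a) ((hint w).const_mul b)]
    refine integral_mono_ae (hint _) (((hint v).const_mul a).add ((hint w).const_mul b)) ?_
    filter_upwards [hin] with ω h
    have := (spl_strong R).2 (abs_le.1 (h v hv)) (abs_le.1 (h w hw)) ha hb hab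
    simp only [smul_eq_mul, ← hm] at this
    simp only [inner_add_right, inner_smul_right]
    linarith
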